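/- (Lemma 2.2, exact closed form.) Let p ∈ ℝ³, η > 0, T > η, τ > 0, and let x ∈ ℝ³ satisfy 0 < |x − p| < T − η. Then (τ²/(4π)) ∫_{{y : T−η < |y−p| < T+η}} ( e^{−τ|x−y|}/|x−y| ) · ( τ v(y,T) − ∂_t v(y,T) ) dy = e^{−τ(T−η)} · 𝓗(τ) · sinh(τ|x − p|)/|x − p|, where 𝓗(τ) := (1/τ)(η − 2/τ) + (4/τ²)e^{−τη} − (1/τ)(η + 2/τ)e^{−2τη}. In particular τ·𝓗(τ) = η + O(1/τ) as τ → ∞, so there exist C > 0 and τ₀ > 0 with |τ·𝓗(τ) − η| ≤ C/τ for all τ ≥ τ₀. Here ∂_t v(y,T) denotes the derivative of s ↦ v(y,s) at s = T. -/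

import Mathlib

open MeasureTheory Real

noncomputable def PsiB (p : EuclideanSpace ℝ (Fin 3)) (η : ℝ)
    (x : EuclideanSpace ℝ (Fin 3)) : ℝ :=
  if ‖x - p‖ < η then η - ‖x - p‖ else 0

/-- `v(x,t) = (t/(4π)) ∫_{S²} Ψ_B(x + tω) dσ(ω)`, where `σ = volume.toSphere` is the
surface measure on the unit sphere in `ℝ³` (total mass `4π`). -/
noncomputable def waveV (p : EuclideanSpace ℝ (Fin 3)) (η : ℝ)
    (x : EuclideanSpace ℝ (Fin 3)) (t : ℝ) : ℝ :=
  (t / (4 * π)) *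
    ∫ ω : Metric.sphere (0 : EuclideanSpace ℝ (Fin 3)) 1,
      PsiB p η (x + t • (ω : EuclideanSpace ℝ (Fin 3)))
      ∂((volume : Measure (EuclideanSpace ℝ (Fin 3))).toSphere)
/-- `𝓗(τ) = (1/τ)(η − 2/τ) + (4/τ²)e^{−τη} − (1/τ)(η + 2/τ)e^{−2τη}`. -/
noncomputable def calH (η τ : ℝ) : ℝ :=
  (1 / τ) * (η - 2 / τ) + (4 / τ ^ 2) * Real.exp (-τ * η)
    - (1 / τ) * (η + 2 / τ) * Real.exp (-2 * τ * η)

abbrev E3 := EuclideanSpace ℝ (Fin 3)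

lemma polar2 (g : ℝ → ENNReal) (hg : Measurable g) :
    ∫⁻ q : ℝ × ℝ, g (q.1 ^ 2 + q.2 ^ 2) =
      ENNReal.ofReal (2 * π) * ∫⁻ r in Set.Ioi (0:ℝ), ENNReal.ofReal r * g (r ^ 2) := by
  rw [← lintegral_comp_polarCoord_symm, polarCoord_target]
  have : ∀ q : ℝ × ℝ, ENNReal.ofReal q.1 • g ((polarCoord.symm q).1 ^ 2 + (polarCoord.symm q).2 ^ 2)
      = ENNReal.ofReal q.1 * g (q.1 ^ 2) := by
    intro q
    simp only [polarCoord_symm_apply, smul_eq_mul]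
    congr 2
    nlinarith [Real.sin_sq_add_cos_sq q.2]
  simp_rw [this]
  rw [Measure.volume_eq_prod, setLIntegral_prod _ (by fun_prop)]
  simp only [setLIntegral_const, Real.volume_Ioo]
  rw [lintegral_mul_const _ (by fun_prop), mul_comm]
  congr 2; ring

lemma subst1 (z : ℝ) (g : ℝ → ENNReal) :
    ∫⁻ r in Set.Ioi (0:ℝ), ENNReal.ofReal r * g (√(z ^ 2 + r ^ 2)) =
      ∫⁻ s in Set.Ioi |z|, ENNReal.ofReal s * g s := by
  have him : (fun r => √(z ^ 2 + r ^ 2)) '' Set.Ioi (0:ℝ) = Set.Ioi |z| := by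
    ext s
    simp only [Set.mem_image, Set.mem_Ioi]
    constructor
    · rintro ⟨r, hr, rfl⟩
      rw [← Real.sqrt_sq_eq_abs]
      apply Real.sqrt_lt_sqrt (by positivity)
      nlinarith
    · intro hs
      have h0 : 0 ≤ |z| := abs_nonneg z
      have : 0 < s ^ 2 - z ^ 2 := by
        rw [← sq_abs z]; nlinarith
      refine ⟨√(s ^ 2 - z ^ 2), Real.sqrt_pos.2 this, ?_⟩
      rw [Real.sq_sqrt this.le]
      rw [show z ^ 2 + (s ^ 2 - z ^ 2) = s ^ 2 by ring, Real.sqrt_sq (by linarith)]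
  rw [← him, lintegral_image_eq_lintegral_abs_deriv_mul (f' := fun r => r / √(z ^ 2 + r ^ 2))
    measurableSet_Ioi]
  · apply setLIntegral_congr_fun measurableSet_Ioi
    intro r hr
    have hr : 0 < r := hr
    have h1 : 0 < √(z ^ 2 + r ^ 2) := Real.sqrt_pos.2 (by positivity)
    simp only
    rw [← mul_assoc, ← ENNReal.ofReal_mul (abs_nonneg _), abs_of_pos (by positivity)]
    congr 2
    field_simp
  · intro r hr
    have hr : 0 < r := hr
    have h1 : 0 < √(z ^ 2 + r ^ 2) := Real.sqrt_pos.2 (by positivity)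
    have : HasDerivAt (fun r : ℝ => z ^ 2 + r ^ 2) (2 * r) r := by
      simpa using ((hasDerivAt_id r).pow 2).const_add (z ^ 2)
    convert! (this.sqrt (by positivity)).hasDerivWithinAt using 1
    field_simp
  · intro a ha b hb hab
    have ha : 0 < a := ha
    have hb : 0 < b := hb
    simp only at hab
    rw [Real.sqrt_inj (by positivity) (by positivity)] at hab
    nlinarith [sq_nonneg (a - b)]

lemma cyl (f : ℝ × ℝ → ENNReal) (hf : Measurable f) :
    ∫⁻ x : E3, f (x 0, ‖x‖) =
      ENNReal.ofReal (2 * π) * ∫⁻ z : ℝ, ∫⁻ s in Set.Ioi |z|, ENNReal.ofReal s * f (z, s) := by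
  have h1 : ∫⁻ x : E3, f (x 0, ‖x‖) =
      ∫⁻ x : Fin 3 → ℝ, f (x 0, √(x 0 ^ 2 + (x 1 ^ 2 + x 2 ^ 2))) := by
    rw [← (PiLp.volume_preserving_ofLp (Fin 3)).lintegral_comp (by fun_prop)]
    congr 1; ext x
    rw [EuclideanSpace.norm_eq, Fin.sum_univ_three]
    simp [add_assoc]
  have h2 : ∫⁻ x : Fin 3 → ℝ, f (x 0, √(x 0 ^ 2 + (x 1 ^ 2 + x 2 ^ 2))) =
      ∫⁻ q : ℝ × (Fin 2 → ℝ), f (q.1, √(q.1 ^ 2 + (q.2 0 ^ 2 + q.2 1 ^ 2))) := by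
    rw [← (volume_preserving_piFinSuccAbove (fun _ : Fin 3 => ℝ) 0).lintegral_comp (by fun_prop)]
    rfl
  rw [h1, h2, Measure.volume_eq_prod, lintegral_prod _ (by fun_prop)]
  rw [← lintegral_const_mul' _ _ ENNReal.ofReal_ne_top]
  congr 1; ext z
  have h3 : ∫⁻ q : Fin 2 → ℝ, f (z, √(z ^ 2 + (q 0 ^ 2 + q 1 ^ 2))) =
      ∫⁻ q : ℝ × ℝ, f (z, √(z ^ 2 + (q.1 ^ 2 + q.2 ^ 2))) := by
    rw [← (volume_preserving_finTwoArrow ℝ).lintegral_comp (by fun_prop)]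
    rfl
  rw [h3, polar2 (fun a => f (z, √(z ^ 2 + a))) (by fun_prop), subst1 z (fun s => f (z, s))]

lemma sector (A : Set ℝ) (hA : MeasurableSet A) :
    3 * volume {x : E3 | ‖x‖ ∈ Set.Ioo (0:ℝ) 1 ∧ x 0 / ‖x‖ ∈ A} =
      ENNReal.ofReal (2 * π) * volume (A ∩ Set.Ioo (-1) 1) := by
  set S : Set (ℝ × ℝ) := {q | q.2 ∈ Set.Ioo (0:ℝ) 1 ∧ q.1 / q.2 ∈ A} with hS
  have hSm : MeasurableSet S := by
    apply MeasurableSet.inter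
    · exact measurable_snd measurableSet_Ioo
    · exact (measurable_fst.div measurable_snd) hA
  have hm : Measurable (fun x : E3 => (x 0, ‖x‖)) := by fun_prop
  have h1 := cyl (S.indicator 1) (measurable_one.indicator hSm)
  have h2 : ∫⁻ x : E3, S.indicator 1 (x 0, ‖x‖) =
      volume {x : E3 | ‖x‖ ∈ Set.Ioo (0:ℝ) 1 ∧ x 0 / ‖x‖ ∈ A} := by
    rw [show {x : E3 | ‖x‖ ∈ Set.Ioo (0:ℝ) 1 ∧ x 0 / ‖x‖ ∈ A} = (fun x : E3 => (x 0, ‖x‖)) ⁻¹' S from rfl]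
    rw [← lintegral_indicator_one (hm hSm)]
    rfl
  rw [← h2, h1, mul_left_comm]
  congr 1
  have h3 : ∀ z : ℝ, ∫⁻ s in Set.Ioi |z|, ENNReal.ofReal s * S.indicator 1 (z, s) =
      ∫⁻ s : ℝ, (Set.Ioo (0:ℝ) 1).indicator (fun s => ENNReal.ofReal s * (A ∩ Set.Ioo (-1) 1).indicator 1 (s⁻¹ * z)) s := by
    intro z
    rw [← lintegral_indicator measurableSet_Ioi]
    congr 1; ext s
    have hmem : (z, s) ∈ S ↔ (0 < s ∧ s < 1) ∧ z / s ∈ A := Iff.rfl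
    by_cases hs : 0 < s
    · have m2 : s⁻¹ * z ∈ A ∩ Set.Ioo (-1) 1 ↔ z / s ∈ A ∧ |z| < s := by
        rw [Set.mem_inter_iff, Set.mem_Ioo, abs_lt, inv_mul_eq_div, lt_div_iff₀ hs, div_lt_iff₀ hs]
        simp
      by_cases hz : |z| < s <;> by_cases hs1 : s < 1 <;> by_cases hA' : z / s ∈ A <;>
        simp only [Set.indicator, m2, hmem, hs, hs1, hA', hz, Set.mem_Ioi, Set.mem_Ioo] <;> simp
    · simp [Set.indicator, hmem, hs]
  simp_rw [h3]
  have hAm : MeasurableSet (A ∩ Set.Ioo (-1) 1) := hA.inter measurableSet_Ioo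
  rw [lintegral_lintegral_swap]
  · have h4 : ∀ s : ℝ, ∫⁻ z : ℝ, (Set.Ioo (0:ℝ) 1).indicator (fun s => ENNReal.ofReal s * (A ∩ Set.Ioo (-1) 1).indicator 1 (s⁻¹ * z)) s
      = (Set.Ioo (0:ℝ) 1).indicator (fun s => ENNReal.ofReal (s ^ 2) * volume (A ∩ Set.Ioo (-1) 1)) s := by
      intro s
      by_cases hs : s ∈ Set.Ioo (0:ℝ) 1
      · simp only [Set.indicator_of_mem hs]
        rw [lintegral_const_mul' _ _ (by simp)]
        have : ∀ z, (A ∩ Set.Ioo (-1) 1).indicator (1 : ℝ → ENNReal) (s⁻¹ * z) = ((fun z => s⁻¹ * z) ⁻¹' (A ∩ Set.Ioo (-1) 1)).indicator 1 z := fun z => rfl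
        simp_rw [this]
        rw [lintegral_indicator_one (measurable_const_mul _ hAm), Real.volume_preimage_mul_left (by simpa using hs.1.ne')]
        rw [← mul_assoc, ← ENNReal.ofReal_mul hs.1.le, inv_inv, abs_of_pos hs.1, sq]
      · simp only [Set.indicator_of_notMem hs]; simp
    simp_rw [h4]
    rw [lintegral_indicator measurableSet_Ioo, lintegral_mul_const _ (by fun_prop), ← mul_assoc]
    rw [← ofReal_integral_eq_lintegral_ofReal]
    · rw [← integral_Ioc_eq_integral_Ioo, ← intervalIntegral.integral_of_le zero_le_one, integral_pow]
      rw [show (3 : ENNReal) = ENNReal.ofReal 3 by simp, ← ENNReal.ofReal_mul (by norm_num)]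
      norm_num
    · exact ((continuous_pow 2).integrableOn_Icc (a := 0) (b := 1)).mono_set Set.Ioo_subset_Icc_self
    · exact Filter.Eventually.of_forall fun s => by positivity
  · apply Measurable.aemeasurable
    have : Measurable (fun q : ℝ × ℝ => (Set.Ioo (0:ℝ) 1).indicator (1 : ℝ → ENNReal) q.2 * (ENNReal.ofReal q.2 * (A ∩ Set.Ioo (-1) 1).indicator (1 : ℝ → ENNReal) (q.2⁻¹ * q.1))) := by
      have a1 : Measurable ((Set.Ioo (0:ℝ) 1).indicator (1 : ℝ → ENNReal)) := measurable_one.indicator measurableSet_Ioo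
      have a2 : Measurable ((A ∩ Set.Ioo (-1) 1).indicator (1 : ℝ → ENNReal)) := measurable_one.indicator hAm
      fun_prop
    convert this using 1
    ext q
    by_cases hs : q.2 ∈ Set.Ioo (0:ℝ) 1 <;> simp [hs, Function.uncurry]

lemma sphere_map (e : E3) (he : ‖e‖ = 1) :
    Measure.map (fun ω : Metric.sphere (0 : E3) 1 => inner ℝ e (ω : E3))
      (volume : Measure E3).toSphere = ENNReal.ofReal (2 * π) • volume.restrict (Set.Ioo (-1) 1) := by
  have hm : Measurable (fun ω : Metric.sphere (0 : E3) 1 => inner ℝ e (ω : E3)) := by fun_prop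
  obtain ⟨b, hb⟩ := Orthonormal.exists_orthonormalBasis_extension_of_card_eq (𝕜 := ℝ) (E := E3) (ι := Fin 3)
    (by simp) (v := fun _ => e) (s := {0}) (by
      constructor
      · intro i; simpa using he
      · intro i j hij; exact absurd (Subsingleton.elim i j) hij)
  have hb0 : b 0 = e := hb 0 rfl
  ext A hA
  rw [Measure.map_apply hm hA, Measure.toSphere_apply' _ (hm hA)]
  rw [Measure.smul_apply, Measure.restrict_apply hA, smul_eq_mul, ← sector A hA]
  have hS : MeasurableSet {x : E3 | ‖x‖ ∈ Set.Ioo (0:ℝ) 1 ∧ x 0 / ‖x‖ ∈ A} := by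
    apply MeasurableSet.inter
    · exact measurable_norm measurableSet_Ioo
    · have : Measurable (fun x : E3 => x 0 / ‖x‖) := by fun_prop
      exact this hA
  rw [← b.measurePreserving_repr.measure_preimage hS.nullMeasurableSet]
  congr 1
  · simp
  congr 1
  ext x
  simp only [Set.mem_smul, Set.mem_image, Set.mem_preimage, Set.mem_ofPred_eq, LinearIsometryEquiv.norm_map,
    OrthonormalBasis.repr_apply_apply, hb0]
  constructor
  · rintro ⟨r, hr, _, ⟨ω, hω, rfl⟩, rfl⟩
    have h1 : ‖(ω : E3)‖ = 1 := by simp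
    have h2 : ‖r • (ω : E3)‖ = r := by rw [norm_smul, h1, Real.norm_eq_abs, abs_of_pos hr.1, mul_one]
    rw [h2, inner_smul_right, mul_div_cancel_left₀ _ hr.1.ne']
    exact ⟨hr, hω⟩
  · rintro ⟨hx, hA'⟩
    have hx0 : ‖x‖ ≠ 0 := hx.1.ne'
    refine ⟨‖x‖, hx, ‖x‖⁻¹ • x, ⟨⟨‖x‖⁻¹ • x, by simp [norm_smul, hx0]⟩, ?_, rfl⟩, ?_⟩
    · simp only [inner_smul_right]
      rwa [inv_mul_eq_div]
    · rw [smul_smul, mul_inv_cancel₀ hx0, one_smul]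

lemma polar3 (φ : E3 → ℝ) (hφ : Integrable φ) :
    ∫ x, φ x = ∫ r in Set.Ioi (0:ℝ), r ^ 2 *
      ∫ ω : Metric.sphere (0 : E3) 1, φ (r • (ω : E3)) ∂(volume : Measure E3).toSphere := by
  have hdim : Module.finrank ℝ E3 - 1 = 2 := by simp
  have mp := (volume : Measure E3).measurePreserving_homeomorphUnitSphereProd
  rw [hdim] at mp
  set Φ : Metric.sphere (0 : E3) 1 × Set.Ioi (0:ℝ) → ℝ := fun q => φ (q.2.1 • (q.1 : E3)) with hΦ
  have hcomp : ∀ x : ({0}ᶜ : Set E3), Φ (homeomorphUnitSphereProd E3 x) = φ x := by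
    intro x
    have hx : (x : E3) ≠ 0 := x.2
    have : ‖(x : E3)‖ ≠ 0 := by simpa using hx
    simp [hΦ, smul_smul, this]
  have h1 : ∫ x, φ x = ∫ x : ({0}ᶜ : Set E3), φ x ∂(volume.comap (Subtype.val)) := by
    rw [integral_subtype_comap (measurableSet_singleton _).compl φ, restrict_compl_singleton]
  have hint : Integrable Φ ((volume : Measure E3).toSphere.prod (Measure.volumeIoiPow 2)) := by
    rw [← mp.integrable_comp_emb (Homeomorph.measurableEmbedding _)]
    have : Φ ∘ (homeomorphUnitSphereProd E3) = φ ∘ (↑) := funext hcomp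
    rw [this, ← integrableOn_iff_comap_subtypeVal (by measurability)]
    exact hφ.integrableOn
  have h2 : ∫ x : ({0}ᶜ : Set E3), φ x ∂(volume.comap (Subtype.val)) =
      ∫ q, Φ q ∂((volume : Measure E3).toSphere.prod (Measure.volumeIoiPow 2)) := by
    rw [← mp.integral_comp (Homeomorph.measurableEmbedding _)]
    simp_rw [hcomp]
  rw [h1, h2, integral_prod_symm _ hint]
  simp only [Measure.volumeIoiPow, ENNReal.ofReal, hΦ]
  rw [integral_withDensity_eq_integral_smul]
  · rw [integral_subtype_comap measurableSet_Ioi fun a : ℝ ↦ Real.toNNReal (a ^ 2) • ∫ ω : Metric.sphere (0 : E3) 1, φ (a • (ω : E3)) ∂(volume : Measure E3).toSphere]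
    apply setIntegral_congr_fun measurableSet_Ioi fun x hx ↦ ?_
    rw [NNReal.smul_def, Real.coe_toNNReal _ (by positivity), smul_eq_mul]
  · exact (measurable_subtype_coe.pow_const _).real_toNNReal

lemma sphere_mean (w : E3) (hw : 0 < ‖w‖) (t : ℝ) (ht : 0 < t) (F : ℝ → ℝ)
    (hF : ContinuousOn F (Set.Icc |‖w‖ - t| (‖w‖ + t))) :
    ∫ ω : Metric.sphere (0 : E3) 1, F ‖w + t • (ω : E3)‖ ∂(volume : Measure E3).toSphere =
      2 * π / (‖w‖ * t) * ∫ s in |‖w‖ - t|..(‖w‖ + t), F s * s := by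
  set r := ‖w‖ with hr
  have he : ‖r⁻¹ • w‖ = 1 := by
    rw [norm_smul, ← hr, norm_inv, Real.norm_eq_abs, abs_of_pos hw, inv_mul_cancel₀ hw.ne']
  have hn : ∀ ω : Metric.sphere (0 : E3) 1, F ‖w + t • (ω : E3)‖ =
      (fun u => F √(r ^ 2 + t ^ 2 + 2 * r * t * u)) (inner ℝ (r⁻¹ • w) (ω : E3)) := by
    intro ω
    have h1 : ‖(ω : E3)‖ = 1 := by simp
    simp only
    congr 1
    rw [← Real.sqrt_sq (norm_nonneg (w + t • (ω : E3))), norm_add_sq_real, ← hr, norm_smul, h1,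
      inner_smul_right, real_inner_smul_left, Real.norm_eq_abs, mul_one, sq_abs]
    congr 1
    field_simp
    ring
  have hm : Measurable (fun ω : Metric.sphere (0 : E3) 1 => inner ℝ (r⁻¹ • w) (ω : E3)) := by fun_prop
  have habs : |r - t| ≤ r + t := abs_le.2 ⟨by linarith, by linarith⟩
  have hsq : ∀ u ∈ Set.Icc (-1:ℝ) 1, √(r ^ 2 + t ^ 2 + 2 * r * t * u) ∈ Set.Icc |r - t| (r + t) := by
    intro u hu
    have hrt : 0 < r * t := by positivity
    constructor
    · apply Real.le_sqrt_of_sq_le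
      rw [sq_abs]; nlinarith [hu.1]
    · rw [Real.sqrt_le_left (by positivity)]
      nlinarith [hu.2]
  have hG : ContinuousOn (fun u => F √(r ^ 2 + t ^ 2 + 2 * r * t * u)) (Set.Icc (-1) 1) :=
    hF.comp (by fun_prop) hsq
  have hGm : AEStronglyMeasurable (fun u => F √(r ^ 2 + t ^ 2 + 2 * r * t * u))
      (ENNReal.ofReal (2 * π) • volume.restrict (Set.Ioo (-1:ℝ) 1)) :=
    ((hG.mono Set.Ioo_subset_Icc_self).aestronglyMeasurable measurableSet_Ioo).smul_measure _
  rw [integral_congr_ae (Filter.Eventually.of_forall hn)]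
  rw [← integral_map (φ := fun ω : Metric.sphere (0 : E3) 1 => inner ℝ (r⁻¹ • w) (ω : E3)) hm.aemeasurable (f := fun u => F √(r ^ 2 + t ^ 2 + 2 * r * t * u))
    (by rw [sphere_map _ he]; exact hGm)]
  rw [sphere_map _ he, integral_smul_measure, ENNReal.toReal_ofReal (by positivity), smul_eq_mul,
    div_eq_mul_one_div (2 * π), mul_assoc (2 * π)]
  congr 1
  rw [← integral_Ioc_eq_integral_Ioo, ← intervalIntegral.integral_of_le (by norm_num)]
  have hsub := intervalIntegral.integral_comp_mul_deriv'' (a := |r - t|) (b := r + t)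
    (f := fun s => (s ^ 2 - r ^ 2 - t ^ 2) / (2 * r * t)) (f' := fun s => s / (r * t))
    (g := fun u => F √(r ^ 2 + t ^ 2 + 2 * r * t * u)) (by fun_prop) (by
      intro s hs
      apply HasDerivAt.hasDerivWithinAt
      have : HasDerivAt (fun s : ℝ => (s ^ 2 - r ^ 2 - t ^ 2) / (2 * r * t)) (2 * s / (2 * r * t)) s := by
        simpa using ((((hasDerivAt_id s).pow 2).sub_const (r ^ 2)).sub_const (t ^ 2)).div_const (2 * r * t)
      convert! this using 1
      field_simp) (by fun_prop) (by
      apply hG.mono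
      rintro _ ⟨s, hs, rfl⟩
      rw [Set.uIcc_of_le habs] at hs
      have h0 := abs_nonneg (r - t)
      have h1 : |r - t| ^ 2 ≤ s ^ 2 := by have := hs.1; gcongr
      have h2 : s ^ 2 ≤ (r + t) ^ 2 := by
        have := hs.2
        have := hs.1
        gcongr
        linarith
      rw [sq_abs] at h1
      simp only
      constructor
      · rw [le_div_iff₀ (by positivity)]; nlinarith
      · rw [div_le_iff₀ (by positivity)]; nlinarith)
  have e1 : (|r - t| ^ 2 - r ^ 2 - t ^ 2) / (2 * r * t) = -1 := by
    rw [sq_abs, div_eq_iff (by positivity)]; ring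
  have e2 : ((r + t) ^ 2 - r ^ 2 - t ^ 2) / (2 * r * t) = 1 := by
    rw [div_eq_iff (by positivity)]; ring
  rw [e1, e2] at hsub
  rw [← hsub, ← intervalIntegral.integral_const_mul]
  apply intervalIntegral.integral_congr
  intro s hs
  rw [Set.uIcc_of_le habs] at hs
  have h0 : 0 ≤ s := le_trans (abs_nonneg _) hs.1
  simp only [Function.comp]
  rw [mul_div_cancel₀ _ (by positivity), show r ^ 2 + t ^ 2 + (s ^ 2 - r ^ 2 - t ^ 2) = s ^ 2 by ring,
    Real.sqrt_sq h0]
  ring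

lemma J1 (η τ : ℝ) (hη : 0 < η) (hτ : 0 < τ) :
    ∫ u in (-η)..η, Real.exp (-τ * u) * (τ * (η ^ 3 / 6 - η * |u| ^ 2 / 2 + |u| ^ 3 / 3) - u * (η - |u|))
      = 2 / τ * (Real.exp (τ * η) * calH η τ) := by
  have hc : Continuous (fun u : ℝ => Real.exp (-τ * u) * (τ * (η ^ 3 / 6 - η * |u| ^ 2 / 2 + |u| ^ 3 / 3) - u * (η - |u|))) := by fun_prop
  have hexp : ∀ u, HasDerivAt (fun u : ℝ => Real.exp (-τ * u)) (Real.exp (-τ * u) * (-τ)) u := by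
    intro u
    simpa using ((hasDerivAt_id u).const_mul (-τ)).exp
  have key : ∀ ε : ℝ, ε ^ 2 = 1 → ∀ u, HasDerivAt (fun u : ℝ => Real.exp (-τ * u) *
      (-(η ^ 3 / 6 - η * u ^ 2 / 2 + ε * u ^ 3 / 3) + 2 * ((η * u - ε * u ^ 2) / τ + (η - ε * 2 * u) / τ ^ 2 - ε * 2 / τ ^ 3)))
      (Real.exp (-τ * u) * (τ * (η ^ 3 / 6 - η * u ^ 2 / 2 + ε * u ^ 3 / 3) - u * (η - ε * u))) u := by
    intro ε hε u
    have hp : HasDerivAt (fun u : ℝ => (-(η ^ 3 / 6 - η * u ^ 2 / 2 + ε * u ^ 3 / 3) + 2 * ((η * u - ε * u ^ 2) / τ + (η - ε * 2 * u) / τ ^ 2 - ε * 2 / τ ^ 3)))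
      (-(- (η * (2 * u) / 2) + ε * (3 * u ^ 2) / 3) + 2 * ((η - ε * (2 * u)) / τ + (- (ε * 2)) / τ ^ 2)) u := by
      have h1 := hasDerivAt_id' u
      have h2 : HasDerivAt (fun u : ℝ => u ^ 2) (2 * u) u := by simpa using h1.fun_pow 2
      have h3 : HasDerivAt (fun u : ℝ => u ^ 3) (3 * u ^ 2) u := by simpa using h1.fun_pow 3
      have a1 := ((((h2.const_mul η).div_const 2).const_sub (η ^ 3 / 6)).add ((h3.const_mul ε).div_const 3)).neg
      have a2 := (((((h1.const_mul η).sub (h2.const_mul ε)).div_const τ).add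
        (((h1.const_mul (ε * 2)).const_sub η).div_const (τ ^ 2))).sub_const (ε * 2 / τ ^ 3)).const_mul 2
      convert! a1.add a2 using 1
      ring
    convert! (hexp u).mul hp using 1
    field_simp
    ring
  rw [← intervalIntegral.integral_add_adjacent_intervals (b := 0) (hc.intervalIntegrable _ _) (hc.intervalIntegrable _ _)]
  have i1 : ∫ u in (-η)..0, Real.exp (-τ * u) * (τ * (η ^ 3 / 6 - η * |u| ^ 2 / 2 + |u| ^ 3 / 3) - u * (η - |u|)) =
      ∫ u in (-η)..0, (Real.exp (-τ * u) * (τ * (η ^ 3 / 6 - η * u ^ 2 / 2 + (-1) * u ^ 3 / 3) - u * (η - (-1) * u))) := by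
    apply intervalIntegral.integral_congr
    intro u hu
    rw [Set.uIcc_of_le (by linarith)] at hu
    simp only [abs_of_nonpos hu.2]
    ring
  have i2 : ∫ u in (0)..η, Real.exp (-τ * u) * (τ * (η ^ 3 / 6 - η * |u| ^ 2 / 2 + |u| ^ 3 / 3) - u * (η - |u|)) =
      ∫ u in (0)..η, (Real.exp (-τ * u) * (τ * (η ^ 3 / 6 - η * u ^ 2 / 2 + 1 * u ^ 3 / 3) - u * (η - 1 * u))) := by
    apply intervalIntegral.integral_congr
    intro u hu
    rw [Set.uIcc_of_le (by linarith)] at hu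
    simp only [abs_of_nonneg hu.1]
    ring
  rw [i1, i2, intervalIntegral.integral_eq_sub_of_hasDerivAt (fun u _ => key (-1) (by norm_num) u)
    (Continuous.intervalIntegrable (by fun_prop) _ _), intervalIntegral.integral_eq_sub_of_hasDerivAt (fun u _ => key 1 (by norm_num) u)
    (Continuous.intervalIntegrable (by fun_prop) _ _)]
  unfold calH
  have e1 : Real.exp (-τ * -η) = Real.exp (τ * η) := by ring_nf
  have e2 : Real.exp (-τ * η) = (Real.exp (τ * η))⁻¹ := by rw [← Real.exp_neg]; ring_nf
  have e3 : Real.exp (-2 * τ * η) = (Real.exp (τ * η))⁻¹ ^ 2 := by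
    rw [← Real.exp_neg, ← Real.exp_nat_mul]; congr 1; push_cast; ring
  rw [e1, e2, e3]
  have := (Real.exp_pos (τ * η)).ne'
  simp only [mul_zero, Real.exp_zero]
  field_simp
  ring

lemma waveV_eq (p y : E3) (η t : ℝ) (hr : 0 < ‖y - p‖) (ht : 0 < t)
    (h1 : |‖y - p‖ - t| ≤ η) (h2 : η ≤ ‖y - p‖ + t) :
    waveV p η y t = (η ^ 3 / 6 - η * |‖y - p‖ - t| ^ 2 / 2 + |‖y - p‖ - t| ^ 3 / 3) / (2 * ‖y - p‖) := by
  have hP : ∀ ω : Metric.sphere (0 : E3) 1, PsiB p η (y + t • (ω : E3)) =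
      (fun s => max (η - s) 0) ‖(y - p) + t • (ω : E3)‖ := by
    intro ω
    rw [PsiB, show y + t • (ω : E3) - p = (y - p) + t • (ω : E3) by abel]
    simp only
    split_ifs with h
    · rw [max_eq_left (by linarith)]
    · rw [max_eq_right (by linarith)]
  unfold waveV
  simp_rw [hP]
  rw [sphere_mean (y - p) hr t ht (fun s => max (η - s) 0) (by fun_prop)]
  have hc : Continuous (fun s : ℝ => max (η - s) 0 * s) := by fun_prop
  rw [← intervalIntegral.integral_add_adjacent_intervals (b := η) (hc.intervalIntegrable _ _) (hc.intervalIntegrable _ _)]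
  set r := ‖y - p‖
  set a := |r - t|
  have i1 : ∫ s in a..η, max (η - s) 0 * s = ∫ s in a..η, (η * s - s ^ 2) := by
    apply intervalIntegral.integral_congr
    intro s hs
    rw [Set.uIcc_of_le h1] at hs
    simp only
    rw [max_eq_left (by linarith [hs.2])]
    ring
  have i2 : ∫ s in η..(r + t), max (η - s) 0 * s = ∫ s in η..(r + t), (0 : ℝ) := by
    apply intervalIntegral.integral_congr
    intro s hs
    rw [Set.uIcc_of_le h2] at hs
    simp only
    rw [max_eq_right (by linarith [hs.1])]
    ring
  rw [i1, i2, intervalIntegral.integral_zero, intervalIntegral.integral_sub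
    (Continuous.intervalIntegrable (by fun_prop) _ _) (Continuous.intervalIntegrable (by fun_prop) _ _),
    intervalIntegral.integral_const_mul, integral_id, integral_pow]
  field_simp
  ring

lemma waveV_deriv (p y : E3) (η T : ℝ) (hT : η < T) (hη : 0 < η)
    (h1 : T - η < ‖y - p‖) (h2 : ‖y - p‖ < T + η) :
    deriv (fun s => waveV p η y s) T = - ((T - ‖y - p‖) * (η - |‖y - p‖ - T|)) / (2 * ‖y - p‖) := by
  set r := ‖y - p‖ with hr
  have hr0 : 0 < r := by linarith
  have hev : (fun s => waveV p η y s) =ᶠ[nhds T]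
      fun t => (η ^ 3 / 6 - η * (r - t) ^ 2 / 2 + |r - t| ^ (3:ℝ) / 3) / (2 * r) := by
    have hI : Set.Ioo (max (r - η) η) (r + η) ∈ nhds T := by
      apply Ioo_mem_nhds
      · exact max_lt (by linarith) hT
      · linarith
    filter_upwards [hI] with t ht
    have ht1 := lt_of_le_of_lt (le_max_left _ _) ht.1
    have ht2 := lt_of_le_of_lt (le_max_right _ _) ht.1
    rw [waveV_eq p y η t hr0 (by linarith) (abs_le.2 ⟨by linarith [ht.2], by linarith⟩) (by linarith), ← hr, sq_abs]
    norm_cast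
  rw [hev.deriv_eq]
  apply HasDerivAt.deriv
  have d1 : HasDerivAt (fun t : ℝ => r - t) (-1) T := (hasDerivAt_id' T).const_sub r
  have d2 := (hasDerivAt_abs_rpow (r - T) (p := 3) (by norm_num)).comp T d1
  have d3 : HasDerivAt (fun t : ℝ => (r - t) ^ 2) (2 * (r - T) * (-1)) T := by simpa using d1.fun_pow 2
  convert! ((((d3.const_mul η).div_const 2).const_sub (η ^ 3 / 6)).add (d2.div_const 3)).div_const (2 * r) using 1
  rw [show (3:ℝ) - 2 = 1 by norm_num, Real.rpow_one]
  ring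

lemma asymp (η : ℝ) (hη : 0 < η) :
    ∃ C > 0, ∃ τ₀ > 0, ∀ τ ≥ τ₀, |τ * calH η τ - η| ≤ C / τ := by
  refine ⟨6 + 1 + 2, by norm_num, 1, one_pos, fun τ hτ => ?_⟩
  have hτ0 : 0 < τ := by linarith
  have hb : ∀ a : ℝ, 0 ≤ a → a * Real.exp (-a) ≤ 1 := by
    intro a ha
    rw [Real.exp_neg, mul_inv_le_iff₀ (Real.exp_pos a)]
    linarith [Real.add_one_le_exp a]
  have h1 : Real.exp (-τ * η) ≤ 1 := Real.exp_le_one_iff.2 (by nlinarith)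
  have h2 : Real.exp (-2 * τ * η) ≤ 1 := Real.exp_le_one_iff.2 (by nlinarith [mul_pos hτ0 hη])
  have h3 : (2 * τ * η) * Real.exp (-2 * τ * η) ≤ 1 := by
    have := hb (2 * τ * η) (by positivity)
    convert this using 3; ring
  have p1 := Real.exp_pos (-τ * η)
  have p2 := Real.exp_pos (-2 * τ * η)
  have e : τ * calH η τ - η = (-2 + 4 * Real.exp (-τ * η) - (τ * η) * Real.exp (-2 * τ * η) - 2 * Real.exp (-2 * τ * η)) / τ := by
    unfold calH; field_simp; ring
  rw [e, abs_div, abs_of_pos hτ0]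
  gcongr
  have h4 : 0 ≤ τ * η * Real.exp (-2 * τ * η) := by positivity
  rw [abs_le]
  constructor <;> nlinarith

lemma kernel_mean (w : E3) (τ r : ℝ) (hτ : 0 < τ) (hw : 0 < ‖w‖) (hr : ‖w‖ < r) :
    ∫ ω : Metric.sphere (0 : E3) 1, Real.exp (-τ * ‖w + r • (ω : E3)‖) / ‖w + r • (ω : E3)‖
      ∂(volume : Measure E3).toSphere =
      4 * π * Real.sinh (τ * ‖w‖) * Real.exp (-τ * r) / (‖w‖ * r * τ) := by
  have hpos : 0 < |‖w‖ - r| := abs_pos.2 (by linarith)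
  rw [sphere_mean w hw r (by linarith) (fun s => Real.exp (-τ * s) / s) (by
    apply ContinuousOn.div (by fun_prop) (by fun_prop)
    intro s hs
    linarith [hs.1])]
  have hab : |‖w‖ - r| = r - ‖w‖ := by rw [abs_of_neg (by linarith)]; ring
  rw [hab]
  set ρ := ‖w‖
  have i1 : ∫ s in (r - ρ)..(ρ + r), Real.exp (-τ * s) / s * s = ∫ s in (r - ρ)..(ρ + r), Real.exp (-τ * s) := by
    apply intervalIntegral.integral_congr
    intro s hs
    rw [Set.uIcc_of_le (by linarith)] at hs
    have : s ≠ 0 := by linarith [hs.1]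
    simp only
    field_simp
  rw [i1, intervalIntegral.integral_comp_mul_left _ (by linarith : -τ ≠ 0), integral_exp, Real.sinh_eq,
    show -τ * (ρ + r) = -(τ * ρ) + (-τ * r) by ring, show -τ * (r - ρ) = (τ * ρ) + (-τ * r) by ring,
    Real.exp_add, Real.exp_add, smul_eq_mul]
  have : r ≠ 0 := by linarith
  field_simp
  ring

theorem stmt_16 (p : EuclideanSpace ℝ (Fin 3)) (η T : ℝ)
    (hη : 0 < η) (hT : η < T) :
    (∀ τ : ℝ, 0 < τ → ∀ x : EuclideanSpace ℝ (Fin 3),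
        0 < ‖x - p‖ → ‖x - p‖ < T - η →
        (τ ^ 2 / (4 * π)) *
            ∫ y in {y : EuclideanSpace ℝ (Fin 3) | T - η < ‖y - p‖ ∧ ‖y - p‖ < T + η},
              Real.exp (-τ * ‖x - y‖) / ‖x - y‖ *
                (τ * waveV p η y T - deriv (fun s => waveV p η y s) T)
          = Real.exp (-τ * (T - η)) * calH η τ *
              Real.sinh (τ * ‖x - p‖) / ‖x - p‖) ∧
      ∃ C > 0, ∃ τ₀ > 0, ∀ τ ≥ τ₀, |τ * calH η τ - η| ≤ C / τ := by
  refine ⟨?_, asymp η hη⟩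
  intro τ hτ x hx0 hxT
  set J : ℝ → ℝ := fun u => τ * (η ^ 3 / 6 - η * |u| ^ 2 / 2 + |u| ^ 3 / 3) - u * (η - |u|) with hJ
  have hJc : Continuous J := by rw [hJ]; fun_prop
  have hρ : ‖p - x‖ = ‖x - p‖ := norm_sub_rev _ _
  set ρ := ‖x - p‖ with hρdef
  set S : Set E3 := {y : E3 | T - η < ‖y - p‖ ∧ ‖y - p‖ < T + η} with hSdef
  set S0 : Set E3 := {z : E3 | T - η < ‖z‖ ∧ ‖z‖ < T + η} with hS0def
  have hSm : MeasurableSet S := by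
    have : Measurable (fun y : E3 => ‖y - p‖) := by fun_prop
    exact this measurableSet_Ioo
  have hS0m : MeasurableSet S0 := measurable_norm measurableSet_Ioo
  set f : E3 → ℝ := fun z => Real.exp (-τ * ‖(p - x) + z‖) / ‖(p - x) + z‖ * (J (‖z‖ - T) / (2 * ‖z‖)) with hf
  have s1 : ∫ y in S, Real.exp (-τ * ‖x - y‖) / ‖x - y‖ *
        (τ * waveV p η y T - deriv (fun s => waveV p η y s) T) = ∫ z, S0.indicator f z := by
    rw [← integral_indicator hSm, ← integral_sub_right_eq_self (S0.indicator f) p]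
    congr 1
    ext y
    by_cases hy : y ∈ S
    · have hy0 : y - p ∈ S0 := hy
      have hy1 : T - η < ‖y - p‖ ∧ ‖y - p‖ < T + η := hy
      rw [Set.indicator_of_mem hy, Set.indicator_of_mem hy0]
      have hr0 : 0 < ‖y - p‖ := by linarith [hy1.1]
      rw [waveV_deriv p y η T hT hη hy1.1 hy1.2, waveV_eq p y η T hr0 (by linarith)
        (abs_le.2 ⟨by linarith [hy1.1], by linarith [hy1.2]⟩) (by linarith [hy1.1])]
      simp only [hf, hJ]
      rw [show p - x + (y - p) = y - x by abel, norm_sub_rev y x]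
      field_simp
      ring
    · have hy0 : y - p ∉ S0 := hy
      rw [Set.indicator_of_notMem hy, Set.indicator_of_notMem hy0]
  have hint : Integrable (S0.indicator f) := by
    rw [integrable_indicator_iff hS0m]
    have hK : IsCompact (Metric.closedBall (0:E3) (T + η) ∩ {z : E3 | T - η ≤ ‖z‖}) :=
      (isCompact_closedBall _ _).inter_right (isClosed_le continuous_const continuous_norm)
    have hfc : ContinuousOn f (Metric.closedBall (0:E3) (T + η) ∩ {z : E3 | T - η ≤ ‖z‖}) := by
      have hz0 : ∀ z ∈ Metric.closedBall (0:E3) (T + η) ∩ {z : E3 | T - η ≤ ‖z‖}, T - η ≤ ‖z‖ := fun z hz => hz.2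
      apply ContinuousOn.mul
      · apply ContinuousOn.div (by fun_prop) (by fun_prop)
        intro z hz
        have h1 := hz0 z hz
        have h2 : ‖z‖ ≤ ‖p - x + z‖ + ‖p - x‖ := by
          have := norm_sub_le (p - x + z) (p - x)
          rwa [add_sub_cancel_left] at this
        rw [hρ] at h2
        linarith
      · apply ContinuousOn.div (by fun_prop) (by fun_prop)
        intro z hz
        have h1 := hz0 z hz
        linarith
    refine (hfc.integrableOn_compact hK).mono_set ?_
    rintro z ⟨h1, h2⟩
    exact ⟨by simpa using h2.le, h1.le⟩
  have s2 : ∀ r ∈ Set.Ioi (0:ℝ), r ^ 2 * ∫ ω : Metric.sphere (0 : E3) 1, S0.indicator f (r • (ω : E3)) ∂(volume : Measure E3).toSphere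
      = (Set.Ioo (T - η) (T + η)).indicator (fun r => 2 * π * Real.sinh (τ * ρ) / (ρ * τ) * (Real.exp (-τ * r) * J (r - T))) r := by
    intro r hr
    have hr : 0 < r := hr
    have hn : ∀ ω : Metric.sphere (0 : E3) 1, ‖r • (ω : E3)‖ = r := by
      intro ω
      have h1 : ‖(ω : E3)‖ = 1 := by simp
      rw [norm_smul, h1, Real.norm_eq_abs, abs_of_pos hr, mul_one]
    by_cases hI : r ∈ Set.Ioo (T - η) (T + η)
    · rw [Set.indicator_of_mem hI]
      have : ∀ ω : Metric.sphere (0 : E3) 1, S0.indicator f (r • (ω : E3)) =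
          Real.exp (-τ * ‖(p - x) + r • (ω : E3)‖) / ‖(p - x) + r • (ω : E3)‖ * (J (r - T) / (2 * r)) := by
        intro ω
        have : r • (ω : E3) ∈ S0 := by
          show T - η < ‖r • (ω : E3)‖ ∧ ‖r • (ω : E3)‖ < T + η
          rw [hn]; exact hI
        rw [Set.indicator_of_mem this]
        simp only [hf, hn]
      simp_rw [this]
      rw [integral_mul_const, kernel_mean (p - x) τ r hτ (by rw [hρ]; exact hx0) (by rw [hρ]; linarith [hI.1]), hρ]
      field_simp
      ring
    · rw [Set.indicator_of_notMem hI]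
      have : ∀ ω : Metric.sphere (0 : E3) 1, S0.indicator f (r • (ω : E3)) = 0 := by
        intro ω
        apply Set.indicator_of_notMem
        intro h
        have h' : T - η < ‖r • (ω : E3)‖ ∧ ‖r • (ω : E3)‖ < T + η := h
        rw [hn] at h'
        exact hI h'
      simp_rw [this]
      simp
  rw [s1, polar3 _ hint, setIntegral_congr_fun measurableSet_Ioi s2, setIntegral_indicator measurableSet_Ioo,
    Set.inter_eq_right.2 (fun r hr => by
      have : T - η < r := hr.1
      show 0 < r
      linarith), ← integral_Ioc_eq_integral_Ioo, ← intervalIntegral.integral_of_le (by linarith),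
    intervalIntegral.integral_const_mul]
  have s3 : ∫ r in (T - η)..(T + η), Real.exp (-τ * r) * J (r - T) =
      Real.exp (-τ * T) * (2 / τ * (Real.exp (τ * η) * calH η τ)) := by
    rw [← J1 η τ hη hτ, ← intervalIntegral.integral_const_mul]
    have := intervalIntegral.integral_comp_sub_right (a := T - η) (b := T + η)
      (fun u => Real.exp (-τ * T) * (Real.exp (-τ * u) * J u)) T
    rw [show T - η - T = -η by ring, show T + η - T = η by ring] at this
    rw [← this]
    congr 1
    ext r
    rw [← mul_assoc, ← Real.exp_add]
    congr 2
    ring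
  rw [s3, show -τ * (T - η) = -τ * T + τ * η by ring, Real.exp_add]
  field_simp
  ring
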